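/- For n ≥ 1 and 1 ≤ i ≤ n let T_i = b a^{2i−2} b a^{2i−1} b and let s_n = T_1 a^{2^n} T_2 a^{2^n} ⋯ T_{n−1} a^{2^n} T_n be a string over the alphabet {a,b}. Then: (i) |s_n| ≥ (n−1)·2^n, so |s_n| = Ω(2^n); (ii) there is an absolute constant c such that for every n the string s_n is defined by an SLP of size at most c·n; (iii) for all constants 0 < α ≤ β there exist c' > 0 and n₀ such that for all n ≥ n₀, every (α,β)-path balanced SLP defining s_n has size at least c'·n². -/

import Mathlib

/-- A straight-line program: every variable has exactly one rule `rhs A`,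
and a ranking witnesses acyclicity (variables on right-hand sides have
smaller rank), so every variable derives a unique string `val A`. -/
structure SLP (V : Type) (Γ : Type) where
  rhs : V → List (V ⊕ Γ)
  rank : V → ℕ
  rank_lt : ∀ A B, Sum.inl B ∈ rhs A → rank B < rank A
  start : V

namespace SLP

variable {V Γ : Type}

/-- The string derived by a variable. -/
def val (G : SLP V Γ) (A : V) : List Γ :=
  ((G.rhs A).attach.map (fun β =>
    match β with
    | ⟨Sum.inl B, _⟩ => G.val B
    | ⟨Sum.inr a, _⟩ => [a])).flatten
termination_by G.rank A
decreasing_by exact G.rank_lt _ _ (by assumption)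

/-- A string is defined by the SLP if some variable derives it. -/
def defines (G : SLP V Γ) (s : List Γ) : Prop := ∃ A, G.val A = s

/-- The size of an SLP: total length of all right-hand sides. -/
def size [Fintype V] (G : SLP V Γ) : ℕ := ∑ A : V, (G.rhs A).length

end SLP

/-- Weight of a string over a weighted alphabet. -/
def wstr {Γ : Type} (w : Γ → ℕ) (s : List Γ) : ℕ := (s.map w).sum

namespace SLP

variable {V Γ : Type}

/-- Weight of the string derived by a variable. -/
def wval (G : SLP V Γ) (w : Γ → ℕ) (A : V) : ℕ := wstr w (G.val A)

/-- Weight of a symbol (variable or terminal). -/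
def symWeight (G : SLP V Γ) (w : Γ → ℕ) : V ⊕ Γ → ℕ
  | Sum.inl B => G.wval w B
  | Sum.inr a => w a

/-- An SLP is contracting (w.r.t. the weight `w`) if every variable `B` on the
right-hand side of a rule of `A` satisfies `‖B‖ ≤ ‖A‖/2`. -/
def Contracting (G : SLP V Γ) (w : Γ → ℕ) : Prop :=
  ∀ A B, Sum.inl B ∈ G.rhs A → 2 * G.wval w B ≤ G.wval w A

end SLP


/-- An SLP is in Chomsky normal form: every rule has the form `A → BC` or `A → a`. -/
def SLP.CNF {V Γ : Type} (G : SLP V Γ) : Prop :=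
  ∀ A : V, (∃ B C : V, G.rhs A = [Sum.inl B, Sum.inl C]) ∨ (∃ a : Γ, G.rhs A = [Sum.inr a])

/-- `G.RLP A k` holds iff the derivation tree of `A` (for an SLP in Chomsky normal
form) has a root-to-leaf path with `k` edges. -/
inductive SLP.RLP {V Γ : Type} (G : SLP V Γ) : V → ℕ → Prop
  | term {A : V} {a : Γ} : G.rhs A = [Sum.inr a] → SLP.RLP G A 1
  | left {A B C : V} {k : ℕ} :
      G.rhs A = [Sum.inl B, Sum.inl C] → SLP.RLP G B k → SLP.RLP G A (k + 1)
  | right {A B C : V} {k : ℕ} :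
      G.rhs A = [Sum.inl B, Sum.inl C] → SLP.RLP G C k → SLP.RLP G A (k + 1)

/-- An SLP in Chomsky normal form is `(α,β)`-path balanced if for every variable `A`
with `|val A| ≥ 2`, every root-to-leaf path in the derivation tree of `A` has length
between `α·log₂|A|` and `β·log₂|A|`. -/
def SLP.PathBalanced {V Γ : Type} (G : SLP V Γ) (α β : ℝ) : Prop :=
  G.CNF ∧
    ∀ (A : V) (k : ℕ), 2 ≤ (G.val A).length → G.RLP A k →
      α * Real.logb 2 ((G.val A).length : ℝ) ≤ (k : ℝ) ∧
      (k : ℝ) ≤ β * Real.logb 2 ((G.val A).length : ℝ)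

/-- The separator string `T_i = b a^(2i−2) b a^(2i−1) b` over the alphabet `{a,b}`,
where `a` is modelled by `false` and `b` by `true`. -/
def Tsep (i : ℕ) : List Bool :=
  [true] ++ List.replicate (2 * i - 2) false ++ [true] ++
    List.replicate (2 * i - 1) false ++ [true]

/-- The string `s_n = T_1 a^(2^n) T_2 a^(2^n) ⋯ T_{n−1} a^(2^n) T_n`. -/
def sepString (n : ℕ) : List Bool :=
  (List.range n).flatMap fun j =>
    Tsep (j + 1) ++ if j + 1 < n then List.replicate (2 ^ n) false else []

namespace SLP

variable {V Γ : Type}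

/-- Unfolding equation for `val` without the attached membership proofs. -/
theorem val_eq_flatMap (G : SLP V Γ) (A : V) :
    G.val A = (G.rhs A).flatMap (Sum.elim G.val fun a => [a]) := by
  rw [val, List.flatMap_def]
  congr 1
  conv_rhs => rw [← List.attach_map_subtype_val (G.rhs A), List.map_map]
  refine List.map_congr_left ?_
  rintro ⟨B | a, h⟩ - <;> rfl

theorem val_of_pair {G : SLP V Γ} {A B C : V} (h : G.rhs A = [Sum.inl B, Sum.inl C]) :
    G.val A = G.val B ++ G.val C := by
  rw [val_eq_flatMap, h]; simp

theorem val_of_terminal {G : SLP V Γ} {A : V} {a : Γ} (h : G.rhs A = [Sum.inr a]) :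
    G.val A = [a] := by
  rw [val_eq_flatMap, h]; simp

theorem CNF.length_val_pos {G : SLP V Γ} (hG : G.CNF) (A : V) : 0 < (G.val A).length := by
  induction hr : G.rank A using Nat.strong_induction_on generalizing A with
  | _ r ih =>
    rcases hG A with ⟨B, C, h⟩ | ⟨a, h⟩
    · have := ih _ (hr ▸ G.rank_lt A B (by simp [h])) B rfl
      rw [val_of_pair h, List.length_append]
      omega
    · simp [val_of_terminal h]

theorem RLP.two_le_length {G : SLP V Γ} (hG : G.CNF) {A : V} {k : ℕ} (h : G.RLP A k)
    (hk : 2 ≤ k) : 2 ≤ (G.val A).length := by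
  have key : ∀ {B C : V}, G.rhs A = [Sum.inl B, Sum.inl C] → 2 ≤ (G.val A).length := by
    intro B C h
    have h1 := hG.length_val_pos B
    have h2 := hG.length_val_pos C
    rw [val_of_pair h, List.length_append]
    omega
  cases h with
  | term h => omega
  | left h _ => exact key h
  | right h _ => exact key h

theorem CNF.card_le_size [Fintype V] {G : SLP V Γ} (hG : G.CNF) :
    Fintype.card V ≤ G.size := by
  rw [size, Fintype.card_eq_sum_ones]
  refine Finset.sum_le_sum fun A _ => ?_
  rcases hG A with ⟨B, C, h⟩ | ⟨a, h⟩ <;> simp [h]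

/-- The derivation tree of `A` has a path `p k = A, p (k - 1), …, p 1` to a leaf labelled `c`,
indexed by height, which singles out an occurrence of `c` with left context `x` and right
context `y`. -/
def HasPath (G : SLP V Γ) (c : Γ) (A : V) (x y : List Γ) : Prop :=
  ∃ (k : ℕ) (p : ℕ → V), G.RLP A k ∧ p k = A ∧
    (∀ h ∈ Set.Icc 1 k, G.RLP (p h) h ∧
      ∃ x' y', x' <:+ x ∧ y' <+: y ∧ G.val (p h) = x' ++ c :: y') ∧
    StrictMonoOn (fun h => G.rank (p h)) (Set.Icc 1 k)

theorem HasPath.extend {G : SLP V Γ} {c : Γ} {A B : V} {x y x₀ y₀ : List Γ}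
    (hB : G.HasPath c B x₀ y₀) (hAB : Sum.inl B ∈ G.rhs A)
    (hR : ∀ k, G.RLP B k → G.RLP A (k + 1)) (hA : G.val A = x ++ c :: y)
    (hx : x₀ <:+ x) (hy : y₀ <+: y) : G.HasPath c A x y := by
  obtain ⟨k, p, hk, hpk, hp, hmono⟩ := hB
  refine ⟨k + 1, Function.update p (k + 1) A, hR k hk, by simp, ?_, ?_⟩
  · rintro h ⟨h1, h2⟩
    rcases Nat.lt_or_ge k h with hlt | hle
    · obtain rfl : h = k + 1 := by omega
      rw [Function.update_self]
      exact ⟨hR k hk, x, y, List.suffix_rfl, List.prefix_rfl, hA⟩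
    · rw [Function.update_of_ne (by omega)]
      obtain ⟨h3, x', y', hx', hy', h4⟩ := hp h ⟨h1, hle⟩
      exact ⟨h3, x', y', hx'.trans hx, hy'.trans hy, h4⟩
  · rintro h ⟨h1, h2⟩ h' ⟨h1', h2'⟩ hlt
    have hle : h ≤ k := by omega
    change G.rank (Function.update p (k + 1) A h) < G.rank (Function.update p (k + 1) A h')
    rw [Function.update_of_ne (by omega)]
    rcases Nat.lt_or_ge k h' with hlt' | hle'
    · obtain rfl : h' = k + 1 := by omega
      rw [Function.update_self]
      calc G.rank (p h) ≤ G.rank (p k) :=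
            hmono.monotoneOn ⟨h1, hle⟩ ⟨by omega, le_rfl⟩ hle
        _ < G.rank A := hpk ▸ G.rank_lt A B hAB
    · rw [Function.update_of_ne (by omega)]
      exact hmono ⟨h1, hle⟩ ⟨h1', hle'⟩ hlt

theorem CNF.hasPath {G : SLP V Γ} (hG : G.CNF) (c : Γ) (A : V) (x y : List Γ)
    (hA : G.val A = x ++ c :: y) : G.HasPath c A x y := by
  induction hr : G.rank A using Nat.strong_induction_on generalizing A x y with
  | _ r ih =>
    rcases hG A with ⟨B, C, h⟩ | ⟨a, h⟩
    · have hB : Sum.inl B ∈ G.rhs A := by simp [h]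
      have hC : Sum.inl C ∈ G.rhs A := by simp [h]
      have hsplit := hA
      rw [val_of_pair h, List.append_eq_append_iff] at hsplit
      rcases hsplit with ⟨a', hx, hC'⟩ | ⟨c', hB', hc⟩
      · exact (ih _ (hr ▸ G.rank_lt A C hC) C a' y hC' rfl).extend hC
          (fun k hk => RLP.right h hk) hA ⟨_, hx.symm⟩ List.prefix_rfl
      · cases c' with
        | nil =>
          exact (ih _ (hr ▸ G.rank_lt A C hC) C [] y (by simpa using hc.symm) rfl).extend hC
            (fun k hk => RLP.right h hk) hA (List.nil_suffix) List.prefix_rfl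
        | cons d c'' =>
          rw [List.cons_append, List.cons.injEq] at hc
          obtain ⟨rfl, hy⟩ := hc
          exact (ih _ (hr ▸ G.rank_lt A B hB) B x c'' hB' rfl).extend hB
            (fun k hk => RLP.left h hk) hA List.suffix_rfl ⟨_, hy.symm⟩
    · refine ⟨1, fun _ => A, .term h, rfl, ?_, ?_⟩
      · rintro k ⟨h1, h2⟩
        obtain rfl : k = 1 := by omega
        exact ⟨.term h, x, y, List.suffix_rfl, List.prefix_rfl, hA⟩
      · rintro k ⟨h1, h2⟩ k' ⟨h1', h2'⟩ hlt
        omega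

end SLP

theorem le_length_sepString (n : ℕ) : (n - 1) * 2 ^ n ≤ (sepString n).length := by
  cases n with
  | zero => simp
  | succ m =>
    rw [sepString, List.range_succ, List.flatMap_append, List.length_append, List.length_flatMap]
    refine le_trans ?_ (Nat.le_add_right _ _)
    refine le_trans (le_of_eq ?_) (List.card_nsmul_le_sum _ (2 ^ (m + 1)) ?_)
    · simp
    · intro z hz
      obtain ⟨j, hj, rfl⟩ := List.mem_map.1 hz
      rw [List.mem_range] at hj
      simp [hj]

/-- Half the length of the first block of `false`s enclosed by two `true`s. -/
def firstGapHalf (l : List Bool) : ℕ :=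
  ((l.dropWhile (!·)).tail.takeWhile (!·)).length / 2

theorem firstGapHalf_eq (p m : ℕ) (z : List Bool) :
    firstGapHalf (List.replicate p false ++ true :: (List.replicate m false ++ true :: z)) =
      m / 2 := by
  have h1 : ∀ (p : ℕ) (w : List Bool),
      (List.replicate p false ++ true :: w).dropWhile (!·) = true :: w := by
    intro p w
    induction p with
    | zero => simp
    | succ p ih => simp [List.replicate_succ]
  have h2 : ∀ (m : ℕ) (w : List Bool),
      (List.replicate m false ++ true :: w).takeWhile (!·) = List.replicate m false := by
    intro m w
    induction m with
    | zero => simp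
    | succ m ih => simp [List.replicate_succ]
  rw [firstGapHalf, h1, List.tail_cons, h2, List.length_replicate]

theorem exists_sepString_eq {n j : ℕ} (hj : j < n) :
    ∃ X Y : List Bool, (X = [] ∨ ∃ Z, X = Z ++ List.replicate (2 ^ n) false) ∧
      sepString n = (X ++ true :: List.replicate (2 * j) false) ++
        true :: (List.replicate (2 * j + 1) false ++ true :: Y) := by
  obtain ⟨d, rfl⟩ := Nat.exists_eq_add_of_lt hj
  refine ⟨(List.range j).flatMap fun i => Tsep (i + 1) ++
    if i + 1 < j + d + 1 then List.replicate (2 ^ (j + d + 1)) false else [], ?_⟩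
  rw [sepString, show j + d + 1 = j + (d + 1) by ring, List.range_add, List.flatMap_append,
    List.range_succ_eq_map, List.map_cons, List.flatMap_cons]
  refine exists_and_left.2 ⟨?_, ?_⟩
  rotate_left
  · simp only [Tsep, Nat.add_zero, show 2 * (j + 1) - 2 = 2 * j by omega,
      show 2 * (j + 1) - 1 = 2 * j + 1 by omega, List.append_assoc, List.cons_append,
      List.nil_append]
    exact ⟨_, rfl⟩
  · cases j with
    | zero => simp
    | succ m =>
      right
      rw [List.range_succ, List.flatMap_append]
      refine ⟨((List.range m).flatMap fun i => Tsep (i + 1) ++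
        if i + 1 < m + 1 + (d + 1) then List.replicate (2 ^ (m + 1 + (d + 1))) false else []) ++
          Tsep (m + 1), ?_⟩
      rw [List.flatMap_singleton, if_pos (by omega), List.append_assoc]

theorem suffix_separator_cases {N m : ℕ} {X x : List Bool}
    (hX : X = [] ∨ ∃ Z, X = Z ++ List.replicate N false)
    (hx : x <:+ X ++ true :: List.replicate m false) (hlen : x.length ≤ N) :
    (∃ p ≤ m, x = List.replicate p false) ∨
      ∃ p, x = List.replicate p false ++ true :: List.replicate m false := by
  rcases Nat.lt_or_ge m x.length with h | h
  · right
    have h1 : true :: List.replicate m false <:+ x :=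
      List.suffix_of_suffix_length_le (List.suffix_append _ _) hx (by simpa using h)
    obtain ⟨w, rfl⟩ := h1
    have hw : w <:+ X := by
      obtain ⟨t, ht⟩ := hx
      rw [← List.append_assoc] at ht
      exact ⟨t, List.append_cancel_right ht⟩
    refine ⟨w.length, ?_⟩
    congr 1
    rcases hX with rfl | ⟨Z, rfl⟩
    · rw [List.suffix_nil.1 hw]; rfl
    · have hw' : w <:+ List.replicate N false :=
        List.suffix_of_suffix_length_le hw (List.suffix_append _ _)
          (by simp at hlen ⊢; omega)
      exact List.eq_replicate_length.2 fun b hb => List.eq_of_mem_replicate (hw'.subset hb)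
  · left
    refine ⟨x.length, h, ?_⟩
    have hx' : x <:+ List.replicate m false := by
      refine List.suffix_of_suffix_length_le hx ?_ (by simpa using h)
      exact (List.suffix_cons _ _).trans (List.suffix_append _ _)
    exact List.eq_replicate_length.2 fun b hb => List.eq_of_mem_replicate (hx'.subset hb)

/-- A factor of medium length around the middle `true` of a separator determines its index. -/
theorem firstGapHalf_factor {N j : ℕ} {X Y x y : List Bool}
    (hX : X = [] ∨ ∃ Z, X = Z ++ List.replicate N false)
    (hx : x <:+ X ++ true :: List.replicate (2 * j) false)
    (hy : y <+: List.replicate (2 * j + 1) false ++ true :: Y)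
    (hmin : 4 * (j + 1) ≤ (x ++ true :: y).length) (hmax : (x ++ true :: y).length ≤ N) :
    firstGapHalf (x ++ true :: y) = j := by
  simp only [List.length_append, List.length_cons] at hmin hmax
  rcases suffix_separator_cases hX hx (by omega) with ⟨p, hp, rfl⟩ | ⟨p, rfl⟩
  · have hy' : List.replicate (2 * j + 1) false ++ [true] <+: y := by
      refine List.prefix_of_prefix_length_le (l₃ := List.replicate (2 * j + 1) false ++ true :: Y)
        ⟨Y, by simp⟩ hy ?_
      simp at hmin ⊢
      omega
    obtain ⟨z, rfl⟩ := hy'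
    rw [List.append_assoc, List.singleton_append, firstGapHalf_eq]
    omega
  · rw [List.append_assoc, List.cons_append, firstGapHalf_eq]
    omega

/-- If the heights in `Icc lo hi` force the derived strings to have medium length, then the
variables on the paths to the `n` separators are pairwise distinct. -/
theorem mul_card_heights_le {V : Type} [Fintype V] {G : SLP V Bool} (hG : G.CNF) {n lo hi : ℕ}
    {A : V} (hA : G.val A = sepString n) (hlo : 1 ≤ lo) (hroot : ∀ k, G.RLP A k → hi ≤ k)
    (hlen : ∀ B h, lo ≤ h → h ≤ hi → G.RLP B h →
      4 * n ≤ (G.val B).length ∧ (G.val B).length ≤ 2 ^ n) :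
    n * (hi + 1 - lo) ≤ Fintype.card V := by
  have key : ∀ j : Fin n, ∃ p : ℕ → V,
      (∀ h ∈ Finset.Icc lo hi, firstGapHalf (G.val (p h)) = j) ∧
        StrictMonoOn (fun h => G.rank (p h)) (Set.Icc lo hi) := by
    intro j
    obtain ⟨X, Y, hX, hs⟩ := exists_sepString_eq j.isLt
    obtain ⟨k, p, hk, -, hp, hmono⟩ := hG.hasPath true A _ _ (hA.trans hs)
    have hik := hroot k hk
    refine ⟨p, fun h hh => ?_, hmono.mono (Set.Icc_subset_Icc hlo hik)⟩
    rw [Finset.mem_Icc] at hh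
    obtain ⟨hR, x, y, hx, hy, hv⟩ := hp h ⟨hlo.trans hh.1, hh.2.trans hik⟩
    obtain ⟨h1, h2⟩ := hlen (p h) h hh.1 hh.2 hR
    rw [hv] at h1 h2 ⊢
    exact firstGapHalf_factor hX hx hy (by have := j.isLt; omega) h2
  choose p hgap hmono using key
  have hcard := Finset.card_le_card_of_injOn (s := Finset.univ ×ˢ Finset.Icc lo hi)
    (t := (Finset.univ : Finset V)) (fun q : Fin n × ℕ => p q.1 q.2) (by simp) (by
      rintro ⟨j, h⟩ hjh ⟨j', h'⟩ hjh' heq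
      simp only [Finset.coe_product, Set.mem_prod, Finset.mem_coe, Finset.mem_univ,
        true_and] at hjh hjh' heq
      obtain rfl : j = j' := Fin.ext (by rw [← hgap j h hjh, heq, hgap j' h' hjh'])
      rw [(hmono j).injOn (by simpa using hjh) (by simpa using hjh')
        (congrArg G.rank heq)])
  simpa using hcard

theorem eventually_mul_logb_le {α β : ℝ} (hα : 0 < α) (hβ : 0 < β) :
    ∀ᶠ n : ℕ in Filter.atTop, β * Real.logb 2 (4 * n) ≤ α * n / 2 := by
  have hl : (0 : ℝ) < Real.log 2 := Real.log_pos one_lt_two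
  have h4 : Filter.Tendsto (fun n : ℕ => 4 * (n : ℝ)) Filter.atTop Filter.atTop :=
    tendsto_natCast_atTop_atTop.const_mul_atTop (by norm_num)
  have h := (Real.isLittleO_log_id_atTop.comp_tendsto h4).def
    (show (0 : ℝ) < α * Real.log 2 / (8 * β) by positivity)
  filter_upwards [h, Filter.eventually_ge_atTop 1] with n hn hn1
  have hn' : (0 : ℝ) ≤ 4 * n := by positivity
  simp only [Function.comp_apply, id, Real.norm_eq_abs, abs_of_nonneg hn'] at hn
  have h1 := (le_abs_self _).trans hn
  rw [Real.logb]
  calc β * (Real.log (4 * n) / Real.log 2)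
      ≤ β * (α * Real.log 2 / (8 * β) * (4 * n) / Real.log 2) := by gcongr
    _ = α * n / 2 := by field_simp; ring

theorem pathBalanced_sepString_size_lower_bound {α β : ℝ} (hα : 0 < α) (hαβ : α ≤ β) :
    ∀ᶠ n : ℕ in Filter.atTop, ∀ (V : Type) (_ : Fintype V) (G : SLP V Bool),
      G.PathBalanced α β → G.defines (sepString n) → α / 4 * (n : ℝ) ^ 2 ≤ G.size := by
  have hβ := hα.trans_le hαβ
  have hlin : ∀ᶠ n : ℕ in Filter.atTop, 4 ≤ α * n :=
    (tendsto_natCast_atTop_atTop.const_mul_atTop hα).eventually_ge_atTop 4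
  filter_upwards [eventually_mul_logb_le hα hβ, hlin, Filter.eventually_ge_atTop 2]
    with n hlog hn4 hn2
  rintro V _ G ⟨hG, hbal⟩ ⟨A, hA⟩
  have hn0 : (0 : ℝ) < n := by positivity
  have hceil := Nat.ceil_lt_add_one (show 0 ≤ α * n / 2 by positivity)
  have hfloor := Nat.lt_floor_add_one (α * n)
  have hlo : 2 ≤ ⌈α * n / 2⌉₊ := by
    have : (2 : ℝ) ≤ (⌈α * n / 2⌉₊ : ℝ) := le_trans (by linarith) (Nat.le_ceil _)
    exact_mod_cast this
  have hcard := mul_card_heights_le hG hA (lo := ⌈α * n / 2⌉₊) (hi := ⌊α * n⌋₊) (by omega) ?_ ?_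
  · have hsize : ((n * (⌊α * n⌋₊ + 1 - ⌈α * n / 2⌉₊) : ℕ) : ℝ) ≤ G.size := by
      exact_mod_cast hcard.trans hG.card_le_size
    have hsub : (⌊α * n⌋₊ : ℝ) + 1 - ⌈α * n / 2⌉₊ ≤
        ((⌊α * n⌋₊ + 1 - ⌈α * n / 2⌉₊ : ℕ) : ℝ) := by
      rw [sub_le_iff_le_add]
      exact_mod_cast le_tsub_add (b := ⌊α * n⌋₊ + 1) (a := ⌈α * n / 2⌉₊)
    rw [Nat.cast_mul] at hsize
    calc α / 4 * (n : ℝ) ^ 2 = n * (α * n / 4) := by ring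
      _ ≤ n * ((⌊α * n⌋₊ + 1 - ⌈α * n / 2⌉₊ : ℕ) : ℝ) := by gcongr; linarith
      _ ≤ G.size := hsize
  · intro k hk
    have hlen : 2 ^ n ≤ (G.val A).length := by
      rw [hA]
      exact le_trans (Nat.le_mul_of_pos_left _ (by omega)) (le_length_sepString n)
    have h2 : 2 ≤ (G.val A).length := (Nat.le_self_pow (by omega) 2).trans hlen
    have hk' := (hbal A k h2 hk).1
    have hnl : (n : ℝ) ≤ Real.logb 2 (G.val A).length := by
      rw [Real.le_logb_iff_rpow_le one_lt_two (by positivity), Real.rpow_natCast]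
      exact_mod_cast hlen
    have : ⌊α * n⌋₊ ≤ (k : ℝ) :=
      (Nat.floor_le (by positivity)).trans ((by gcongr : α * n ≤ _).trans hk')
    exact_mod_cast this
  · intro B h h1 h2 hR
    have hB2 := hR.two_le_length hG (hlo.trans h1)
    obtain ⟨hl, hu⟩ := hbal B h hB2 hR
    have hpos : (0 : ℝ) < (G.val B).length := by
      have : 0 < (G.val B).length := by omega
      exact_mod_cast this
    rw [Nat.ceil_le] at h1
    rw [Nat.le_floor_iff (by positivity)] at h2
    constructor
    · have h3 : Real.logb 2 (4 * n) ≤ Real.logb 2 (G.val B).length :=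
        le_of_mul_le_mul_left (by linarith) hβ
      rw [Real.logb_le_logb one_lt_two (by positivity) hpos] at h3
      exact_mod_cast h3
    · have h3 : Real.logb 2 (G.val B).length ≤ n := le_of_mul_le_mul_left (hl.trans h2) hα
      rw [Real.logb_le_iff_le_rpow one_lt_two hpos, Real.rpow_natCast] at h3
      exact_mod_cast h3

/-- A linear-size SLP for `sepString n`: the variables `inl (inl i)` derive `a ^ (2 ^ i)`, the
variables `inl (inr i)` derive `a ^ i`, and `inr ()` derives `sepString n`. -/
def sepSLP (n : ℕ) : SLP ((Fin (n + 1) ⊕ Fin (2 * n + 1)) ⊕ Unit) Bool where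
  rhs
    | .inl (.inl ⟨0, _⟩) => [.inr false]
    | .inl (.inl ⟨i + 1, h⟩) =>
      [.inl (.inl (.inl ⟨i, by omega⟩)), .inl (.inl (.inl ⟨i, by omega⟩))]
    | .inl (.inr ⟨0, _⟩) => []
    | .inl (.inr ⟨i + 1, h⟩) => [.inr false, .inl (.inl (.inr ⟨i, by omega⟩))]
    | .inr () => (List.range n).flatMap fun j =>
      [.inr true, .inl (.inl (.inr (Fin.ofNat _ (2 * j)))), .inr true,
        .inl (.inl (.inr (Fin.ofNat _ (2 * j + 1)))), .inr true] ++
        if j + 1 < n then [.inl (.inl (.inl (Fin.last n)))] else []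
  rank
    | .inl (.inl i) => i
    | .inl (.inr i) => i
    | .inr () => 2 * n + 1
  rank_lt := by
    rintro ((⟨_ | i, hi⟩ | ⟨_ | i, hi⟩) | _) ((B | B) | B) h
    all_goals simp at h
    all_goals try subst h
    all_goals try simp
    all_goals try omega
  start := .inr ()

theorem sepSLP_val_pow (n i : ℕ) (h : i < n + 1) :
    (sepSLP n).val (.inl (.inl ⟨i, h⟩)) = List.replicate (2 ^ i) false := by
  induction i with
  | zero => exact SLP.val_of_terminal rfl
  | succ i ih =>
    rw [SLP.val_of_pair (B := .inl (.inl ⟨i, by omega⟩)) (C := .inl (.inl ⟨i, by omega⟩)) rfl, ih,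
      List.replicate_append_replicate, pow_succ, mul_two]

theorem sepSLP_val_unary (n i : ℕ) (h : i < 2 * n + 1) :
    (sepSLP n).val (.inl (.inr ⟨i, h⟩)) = List.replicate i false := by
  induction i with
  | zero => exact SLP.val_eq_flatMap _ _
  | succ i ih =>
    rw [SLP.val_eq_flatMap, show (sepSLP n).rhs (.inl (.inr ⟨i + 1, h⟩)) =
      [.inr false, .inl (.inl (.inr ⟨i, by omega⟩))] from rfl]
    simp [ih, List.replicate_succ]

theorem sepSLP_val_start (n : ℕ) : (sepSLP n).val (.inr ()) = sepString n := by
  rw [SLP.val_eq_flatMap, sepString]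
  change ((List.range n).flatMap _).flatMap _ = _
  rw [List.flatMap_assoc]
  refine List.flatMap_congr fun j hj => ?_
  rw [List.mem_range] at hj
  have h1 : Fin.ofNat (2 * n + 1) (2 * j) = ⟨2 * j, by omega⟩ :=
    Fin.ext (Nat.mod_eq_of_lt (by omega))
  have h2 : Fin.ofNat (2 * n + 1) (2 * j + 1) = ⟨2 * j + 1, by omega⟩ :=
    Fin.ext (Nat.mod_eq_of_lt (by omega))
  have h3 : Fin.last n = ⟨n, by omega⟩ := rfl
  rw [h1, h2, h3, Tsep, show 2 * (j + 1) - 2 = 2 * j by omega,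
    show 2 * (j + 1) - 1 = 2 * j + 1 by omega]
  split_ifs <;> simp [sepSLP_val_pow, sepSLP_val_unary]

theorem sepSLP_size_le {n : ℕ} (hn : 1 ≤ n) : (sepSLP n).size ≤ 16 * n := by
  have hP : ∀ i : Fin (n + 1), ((sepSLP n).rhs (.inl (.inl i))).length ≤ 2 := by
    rintro ⟨_ | i, h⟩ <;> dsimp only [sepSLP] <;> simp
  have hQ : ∀ i : Fin (2 * n + 1), ((sepSLP n).rhs (.inl (.inr i))).length ≤ 2 := by
    rintro ⟨_ | i, h⟩ <;> dsimp only [sepSLP] <;> simp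
  have hS : ((sepSLP n).rhs (.inr ())).length ≤ n * 6 := by
    change ((List.range n).flatMap _).length ≤ _
    rw [List.length_flatMap]
    refine (List.sum_le_card_nsmul _ 6 ?_).trans (by simp)
    intro z hz
    obtain ⟨j, -, rfl⟩ := List.mem_map.1 hz
    split_ifs <;> simp
  have hP' := Finset.sum_le_card_nsmul Finset.univ _ 2 fun i _ => hP i
  have hQ' := Finset.sum_le_card_nsmul Finset.univ _ 2 fun i _ => hQ i
  simp only [Finset.card_univ, Fintype.card_fin, smul_eq_mul] at hP' hQ'
  rw [SLP.size, Fintype.sum_sum_type, Fintype.sum_sum_type,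
    Fintype.sum_unique fun u : Unit => ((sepSLP n).rhs (.inr u)).length]
  change _ + ((sepSLP n).rhs (.inr ())).length ≤ _
  omega

/-- (i) `|s_n| ≥ (n−1)·2^n`; (ii) there is an absolute constant `c`
such that `s_n` is defined by an SLP of size at most `c·n`; (iii) for all constants
`0 < α ≤ β` there are `c' > 0` and `n₀` such that for all `n ≥ n₀`, every
`(α,β)`-path balanced SLP defining `s_n` has size at least `c'·n²`. -/
theorem separator_string_lower_bound :
    (∀ n : ℕ, 1 ≤ n → (n - 1) * 2 ^ n ≤ (sepString n).length) ∧
    (∃ c : ℕ, ∀ n : ℕ, 1 ≤ n →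
      ∃ (V : Type) (instV : Fintype V) (G : SLP V Bool),
        @SLP.size V Bool instV G ≤ c * n ∧ G.defines (sepString n)) ∧
    (∀ α β : ℝ, 0 < α → α ≤ β →
      ∃ c' : ℝ, 0 < c' ∧ ∃ n₀ : ℕ, ∀ n : ℕ, n₀ ≤ n →
        ∀ (V : Type) (instV : Fintype V) (G : SLP V Bool),
          G.PathBalanced α β → G.defines (sepString n) →
          c' * (n : ℝ) ^ 2 ≤ (@SLP.size V Bool instV G : ℝ)) := by
  refine ⟨fun n _ => le_length_sepString n, ⟨16, fun n hn =>
    ⟨_, inferInstance, sepSLP n, sepSLP_size_le hn, .inr (), sepSLP_val_start n⟩⟩, ?_⟩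
  intro α β hα hαβ
  obtain ⟨n₀, h⟩ := Filter.eventually_atTop.1 (pathBalanced_sepString_size_lower_bound hα hαβ)
  exact ⟨α / 4, by positivity, n₀, h⟩
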